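/- For every λ ∈ [0,1], R ≥ 0 and Δ ≥ 0, G^{(λ)}(R,Δ|P) = sup over μ ≥ 0 of G^{(μ,λ)}(R,Δ|P); in particular G^{(λ)}(R,Δ|P) ≥ G^{(μ,λ)}(R,Δ|P) for every μ ≥ 0, and for every ε > 0 there exists μ ≥ 0 with G^{(λ)}(R,Δ|P) ≤ G^{(μ,λ)}(R,Δ|P) + ε. -/

import Mathlib

open Real Filter

noncomputable section

def IsDist {X : Type*} [Fintype X] (P : X → ℝ) : Prop :=
  (∀ x, 0 ≤ P x) ∧ ∑ x, P x = 1

def IsJoint {X Y : Type*} [Fintype X] [Fintype Y] (q : X → Y → ℝ) : Prop :=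
  (∀ x y, 0 ≤ q x y) ∧ ∑ x, ∑ y, q x y = 1

def IsCond {X Y : Type*} [Fintype X] [Fintype Y] (V : X → Y → ℝ) : Prop :=
  (∀ x y, 0 ≤ V x y) ∧ ∀ x, ∑ y, V x y = 1

def margX {X Y : Type*} [Fintype Y] (q : X → Y → ℝ) (x : X) : ℝ := ∑ y, q x y

def margY {X Y : Type*} [Fintype X] (q : X → Y → ℝ) (y : Y) : ℝ := ∑ x, q x y

/-- conditional distribution of `X` given `Y` : `q_{X|Y}(x|y)` -/
def condXY {X Y : Type*} [Fintype X] (q : X → Y → ℝ) (x : X) (y : Y) : ℝ :=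
  q x y / margY q y

/-- conditional distribution of `Y` given `X` : `q_{Y|X}(y|x)` -/
def condYX {X Y : Type*} [Fintype Y] (q : X → Y → ℝ) (x : X) (y : Y) : ℝ :=
  q x y / margX q x

/-- mutual information `I(q_X, q_{Y|X})` of a joint distribution `q` -/
def mutInfo {X Y : Type*} [Fintype X] [Fintype Y] (q : X → Y → ℝ) : ℝ :=
  ∑ x, ∑ y, q x y * Real.log (q x y / (margX q x * margY q y))

/-- divergence `D(q_X ‖ P)` -/
def klX {X Y : Type*} [Fintype X] [Fintype Y] (q : X → Y → ℝ) (P : X → ℝ) : ℝ :=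
  ∑ x, margX q x * Real.log (margX q x / P x)

/-- divergence `D(p ‖ q)` of distributions on `X` -/
def klD {X : Type*} [Fintype X] (p q : X → ℝ) : ℝ :=
  ∑ x, p x * Real.log (p x / q x)

/-- divergence `D(q ‖ p)` of joint distributions -/
def klJoint {X Y : Type*} [Fintype X] [Fintype Y] (q p : X → Y → ℝ) : ℝ :=
  ∑ x, ∑ y, q x y * Real.log (q x y / p x y)

/-- expected distortion `E_q[d(X,Y)]` -/
def Ed {X Y : Type*} [Fintype X] [Fintype Y] (q d : X → Y → ℝ) : ℝ :=
  ∑ x, ∑ y, q x y * d x y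

/-- `G(R,Δ|P)` -/
def G {X Y : Type*} [Fintype X] [Fintype Y] (P : X → ℝ) (d : X → Y → ℝ) (R Δ : ℝ) : ℝ :=
  sInf {v : ℝ | ∃ q : X → Y → ℝ, IsJoint q ∧ Ed q d ≤ Δ ∧
    v = max 0 (mutInfo q - R) + klX q P}

/-- `G^{(λ)}(R,Δ|P)` -/
def Glam {X Y : Type*} [Fintype X] [Fintype Y] (P : X → ℝ) (d : X → Y → ℝ)
    (lam R Δ : ℝ) : ℝ :=
  sInf {v : ℝ | ∃ q : X → Y → ℝ, IsJoint q ∧ Ed q d ≤ Δ ∧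
    v = lam * (mutInfo q - R) + klX q P}

/-- rate distortion function `R(Δ|P)` -/
def RD {X Y : Type*} [Fintype X] [Fintype Y] (P : X → ℝ) (d : X → Y → ℝ) (Δ : ℝ) : ℝ :=
  sInf {v : ℝ | ∃ V : X → Y → ℝ, IsCond V ∧ Ed (fun x y => P x * V x y) d ≤ Δ ∧
    v = mutInfo (fun x y => P x * V x y)}

/-- `Ω^{(μ,λ)}(P)` -/
def OmegaF {X Y : Type*} [Fintype X] [Fintype Y] (P : X → ℝ) (d : X → Y → ℝ)
    (μ lam : ℝ) : ℝ :=
  sInf {v : ℝ | ∃ q : X → Y → ℝ, IsJoint q ∧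
    v = lam * mutInfo q + klX q P + μ * Ed q d}

/-- `G^{(μ,λ)}(R,Δ|P) = Ω^{(μ,λ)}(P) − λR − μΔ` -/
def Gmulam {X Y : Type*} [Fintype X] [Fintype Y] (P : X → ℝ) (d : X → Y → ℝ)
    (μ lam R Δ : ℝ) : ℝ :=
  OmegaF P d μ lam - lam * R - μ * Δ

/-- `ω_q^{(μ,λ)}(x,y)` -/
def omg {X Y : Type*} [Fintype X] [Fintype Y] (P : X → ℝ) (d : X → Y → ℝ)
    (μ lam : ℝ) (q : X → Y → ℝ) (x : X) (y : Y) : ℝ :=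
  Real.log (margX q x ^ (1 - lam) * condXY q x y ^ lam * Real.exp (μ * d x y) / P x)

/-- `F^{(μ,λ)}(p,q) = E_q[ω_p^{(μ,λ)}(X,Y)] + D(q‖p)` -/
def Ffun {X Y : Type*} [Fintype X] [Fintype Y] (P : X → ℝ) (d : X → Y → ℝ)
    (μ lam : ℝ) (p q : X → Y → ℝ) : ℝ :=
  (∑ x, ∑ y, q x y * omg P d μ lam p x y) + klJoint q p

/-- `Λ_p^{(μ,λ)} = E_p[exp(−ω_p^{(μ,λ)}(X,Y))]` -/
def Lam {X Y : Type*} [Fintype X] [Fintype Y] (P : X → ℝ) (d : X → Y → ℝ)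
    (μ lam : ℝ) (p : X → Y → ℝ) : ℝ :=
  ∑ x, ∑ y, p x y * Real.exp (-(omg P d μ lam p x y))

/-- cutoff rate `R_cut^{(λ)}(Δ|P)` -/
def Rcut {X Y : Type*} [Fintype X] [Fintype Y] (P : X → ℝ) (d : X → Y → ℝ)
    (lam Δ : ℝ) : ℝ :=
  sInf {v : ℝ | ∃ q : X → Y → ℝ, IsJoint q ∧ Ed q d ≤ Δ ∧
    v = mutInfo q + (1 / lam) * klX q P}

/-- Shannon entropy -/
def entropy {X : Type*} [Fintype X] (p : X → ℝ) : ℝ :=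
  -∑ x, p x * Real.log (p x)

open scoped Pointwise in
/-- Lagrange duality for one convex constraint on a compact convex set; by compactness, mere
feasibility suffices in place of Slater's condition. -/
theorem exists_lagrange_multiplier {E : Type*} [AddCommGroup E] [Module ℝ E] [TopologicalSpace E]
    {K : Set E} (hK : IsCompact K) {f g : E → ℝ} (hf : ConvexOn ℝ K f) (hg : ConvexOn ℝ K g)
    (hfc : ContinuousOn f K) (hgc : ContinuousOn g K) {s t : ℝ} {q₀ : E} (hq₀ : q₀ ∈ K)
    (hgq₀ : g q₀ ≤ t) (hs : ∀ q ∈ K, g q ≤ t → s < f q) :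
    ∃ μ : ℝ, 0 ≤ μ ∧ ∀ q ∈ K, s + μ * t ≤ f q + μ * g q := by
  let A : Set (ℝ × ℝ) := {p | ∃ q ∈ K, g q ≤ p.1 ∧ f q ≤ p.2}
  have hA : A = (fun q => (g q, f q)) '' K + Set.Ici (0 : ℝ × ℝ) := by
    ext p
    simp only [A, Set.mem_ofPred_eq, Set.mem_add, Set.mem_image, exists_exists_and_eq_and]
    refine exists_congr fun q => and_congr_right fun _ => ⟨fun h => ?_, ?_⟩
    · exact ⟨p - (g q, f q), by simpa [Prod.le_def] using h, by simp⟩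
    · rintro ⟨z, hz, rfl⟩
      simpa [Prod.le_def] using hz
  have hclosed : IsClosed A := by
    rw [hA]
    exact isClosed_Ici.add_left_of_isCompact (hK.image_of_continuousOn (hgc.prodMk hfc))
  have hconv : Convex ℝ A := by
    rintro p ⟨q, hq, hp1, hp2⟩ p' ⟨q', hq', hp1', hp2'⟩ a b ha hb hab
    refine ⟨a • q + b • q', hf.1 hq hq' ha hb hab, (hg.2 hq hq' ha hb hab).trans ?_,
      (hf.2 hq hq' ha hb hab).trans ?_⟩
    · simp only [smul_eq_mul, Prod.fst_add, Prod.smul_fst]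
      gcongr
    · simp only [smul_eq_mul, Prod.snd_add, Prod.smul_snd]
      gcongr
  have hnot : (t, s) ∉ A := by
    rintro ⟨q, hq, h1, h2⟩
    exact absurd (hs q hq h1) (not_lt.2 h2)
  obtain ⟨φ, u, hu, hφ⟩ := geometric_hahn_banach_point_closed hconv hclosed hnot
  obtain ⟨a, ha⟩ : ∃ a, a = φ (1, 0) := ⟨_, rfl⟩
  obtain ⟨b, hb⟩ : ∃ b, b = φ (0, 1) := ⟨_, rfl⟩
  have hφab : ∀ x y : ℝ, φ (x, y) = a * x + b * y := fun x y => by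
    have h : ((x, y) : ℝ × ℝ) = x • (1, 0) + y • (0, 1) := by simp
    rw [h, map_add, map_smul, map_smul, ha, hb, smul_eq_mul, smul_eq_mul]
    ring
  rw [hφab] at hu
  have key : ∀ q ∈ K, ∀ m n : ℝ, 0 ≤ m → 0 ≤ n → u < a * (g q + m) + b * (f q + n) :=
    fun q hq m n hm hn => by
      rw [← hφab]
      exact hφ _ ⟨q, hq, by simpa using hm, by simpa using hn⟩
  have hbase := key q₀ hq₀ 0 0 le_rfl le_rfl
  have ha0 : 0 ≤ a := by
    by_contra! h
    have := key q₀ hq₀ ((u - a * g q₀ - b * f q₀) / a) 0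
      (div_nonneg_of_nonpos (by linarith) h.le) le_rfl
    have h2 : a * ((u - a * g q₀ - b * f q₀) / a) = u - a * g q₀ - b * f q₀ :=
      mul_div_cancel₀ _ h.ne
    linarith
  have hb0 : 0 ≤ b := by
    by_contra! h
    have := key q₀ hq₀ 0 ((u - a * g q₀ - b * f q₀) / b) le_rfl
      (div_nonneg_of_nonpos (by linarith) h.le)
    have h2 : b * ((u - a * g q₀ - b * f q₀) / b) = u - a * g q₀ - b * f q₀ :=
      mul_div_cancel₀ _ h.ne
    linarith
  have hbpos : 0 < b := by
    refine lt_of_le_of_ne hb0 fun h => ?_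
    subst h
    have := mul_le_mul_of_nonneg_left hgq₀ ha0
    linarith
  refine ⟨a / b, div_nonneg ha0 hb0, fun q hq => ?_⟩
  have h := key q hq 0 0 le_rfl le_rfl
  rw [← mul_le_mul_iff_right₀ hbpos]
  have h1 : b * (s + a / b * t) = a * t + b * s := by field_simp; ring
  have h2 : b * (f q + a / b * g q) = a * g q + b * f q := by field_simp; ring
  linarith

theorem mul_log_add_sub_le_mul_log_div {a b c : ℝ} (ha : 0 ≤ a) (hab : a ≤ b) (hc : 0 < c) :
    a * log c + a - b * c ≤ a * log (a / b) := by
  rcases ha.eq_or_lt with rfl | ha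
  · simpa using mul_nonneg hab hc.le
  · have hb := ha.trans_le hab
    have h := mul_le_mul_of_nonneg_left (log_le_sub_one_of_pos (x := b * c / a) (by positivity))
      ha.le
    rw [log_div (by positivity) ha.ne', log_mul hb.ne' hc.ne'] at h
    rw [log_div ha.ne' hb.ne']
    have h' : a * (b * c / a - 1) = b * c - a := by field_simp
    linarith

/-- The two-term log-sum inequality. -/
theorem add_mul_log_div_add_le {a b a' b' : ℝ} (ha : 0 ≤ a) (hab : a ≤ b) (ha' : 0 ≤ a')
    (hab' : a' ≤ b') :
    (a + a') * log ((a + a') / (b + b')) ≤ a * log (a / b) + a' * log (a' / b') := by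
  rcases (add_nonneg ha ha').eq_or_lt with h | h
  · obtain rfl : a = 0 := by linarith
    obtain rfl : a' = 0 := by linarith
    simp
  · have hb : 0 < b + b' := by linarith
    have hc := div_pos h hb
    have h1 := mul_log_add_sub_le_mul_log_div ha hab hc
    have h2 := mul_log_add_sub_le_mul_log_div ha' hab' hc
    have h3 : (b + b') * ((a + a') / (b + b')) = a + a' := mul_div_cancel₀ _ hb.ne'
    linarith

theorem convex_combo_mul_log_div_le {a b a' b' s t : ℝ} (ha : 0 ≤ a) (hab : a ≤ b) (ha' : 0 ≤ a')
    (hab' : a' ≤ b') (hs : 0 ≤ s) (ht : 0 ≤ t) :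
    (s * a + t * a') * log ((s * a + t * a') / (s * b + t * b')) ≤
      s * (a * log (a / b)) + t * (a' * log (a' / b')) := by
  have hscale : ∀ r x y : ℝ, r * x * log (r * x / (r * y)) = r * (x * log (x / y)) :=
    fun r x y => by
      rcases eq_or_ne r 0 with rfl | hr
      · simp
      · rw [mul_div_mul_left _ _ hr, mul_assoc]
  have h := add_mul_log_div_add_le (mul_nonneg hs ha) (mul_le_mul_of_nonneg_left hab hs)
    (mul_nonneg ht ha') (mul_le_mul_of_nonneg_left hab' ht)
  rwa [hscale, hscale] at h

theorem margX_combo {X Y : Type*} [Fintype Y] (q q' : X → Y → ℝ) (a b : ℝ)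
    (x : X) :
    margX (a • q + b • q') x = a * margX q x + b * margX q' x := by
  simp [margX, Finset.sum_add_distrib, Finset.mul_sum]

theorem margY_combo {X Y : Type*} [Fintype X] (q q' : X → Y → ℝ) (a b : ℝ)
    (y : Y) :
    margY (a • q + b • q') y = a * margY q y + b * margY q' y := by
  simp [margY, Finset.sum_add_distrib, Finset.mul_sum]

@[fun_prop]
theorem continuous_margX {X Y : Type*} [Fintype Y] (x : X) :
    Continuous fun q : X → Y → ℝ => margX q x := by
  unfold margX
  fun_prop

@[fun_prop]
theorem continuous_margY {X Y : Type*} [Fintype X] (y : Y) :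
    Continuous fun q : X → Y → ℝ => margY q y := by
  unfold margY
  fun_prop

section JointDistributions

variable {X Y : Type*} [Fintype X] [Fintype Y]

theorem le_margX {q : X → Y → ℝ} (hq : IsJoint q) (x : X) (y : Y) : q x y ≤ margX q x :=
  Finset.single_le_sum (f := fun y => q x y) (fun y _ => hq.1 x y) (Finset.mem_univ y)

theorem le_margY {q : X → Y → ℝ} (hq : IsJoint q) (x : X) (y : Y) : q x y ≤ margY q y :=
  Finset.single_le_sum (f := fun x => q x y) (fun x _ => hq.1 x y) (Finset.mem_univ x)

theorem margX_nonneg {q : X → Y → ℝ} (hq : IsJoint q) (x : X) : 0 ≤ margX q x :=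
  Finset.sum_nonneg fun y _ => hq.1 x y

theorem sum_margX {q : X → Y → ℝ} (hq : IsJoint q) : ∑ x, margX q x = 1 := hq.2

theorem Ed_combo (d q q' : X → Y → ℝ) (a b : ℝ) :
    Ed (a • q + b • q') d = a * Ed q d + b * Ed q' d := by
  simp [Ed, Finset.sum_add_distrib, Finset.mul_sum, add_mul, mul_assoc]

theorem continuous_Ed (d : X → Y → ℝ) : Continuous fun q => Ed q d := by
  unfold Ed
  fun_prop

theorem Ed_nonneg {q d : X → Y → ℝ} (hq : IsJoint q) (hd : ∀ x y, 0 ≤ d x y) : 0 ≤ Ed q d :=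
  Finset.sum_nonneg fun x _ => Finset.sum_nonneg fun y _ => mul_nonneg (hq.1 x y) (hd x y)

theorem convex_isJoint : Convex ℝ {q : X → Y → ℝ | IsJoint q} := by
  rintro q hq q' hq' a b ha hb hab
  refine ⟨fun x y => add_nonneg (mul_nonneg ha (hq.1 x y)) (mul_nonneg hb (hq'.1 x y)), ?_⟩
  change ∑ x, margX (a • q + b • q') x = 1
  simp only [margX_combo, Finset.sum_add_distrib, ← Finset.mul_sum, sum_margX hq, sum_margX hq',
    mul_one, hab]

theorem isCompact_isJoint : IsCompact {q : X → Y → ℝ | IsJoint q} := by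
  have hbox : IsCompact (Set.pi Set.univ fun _ : X => Set.pi Set.univ fun _ : Y =>
      Set.Icc (0 : ℝ) 1) :=
    isCompact_univ_pi fun _ => isCompact_univ_pi fun _ => isCompact_Icc
  refine hbox.of_isClosed_subset ?_ fun q hq x _ y _ => ⟨hq.1 x y, ?_⟩
  · simp only [IsJoint, Set.ofPred_and, Set.ofPred_forall]
    refine IsClosed.inter (isClosed_iInter fun x => isClosed_iInter fun y => ?_) ?_
    · exact isClosed_le (by fun_prop) (by fun_prop)
    · exact isClosed_eq (by fun_prop) (by fun_prop)
  · exact (le_margX hq x y).trans ((Finset.single_le_sum (fun x _ => margX_nonneg hq x)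
      (Finset.mem_univ x)).trans_eq (sum_margX hq))

/-- The decomposition `I(X;Y) = H(X) - H(X|Y)`. -/
theorem mutInfo_eq_sub {q : X → Y → ℝ} (hq : IsJoint q) :
    mutInfo q = ∑ x, ∑ y, q x y * log (q x y / margY q y) - ∑ x, margX q x * log (margX q x) := by
  simp only [mutInfo, ← Finset.sum_sub_distrib]
  refine Finset.sum_congr rfl fun x _ => ?_
  conv_rhs => rw [show margX q x * log (margX q x) = ∑ y, q x y * log (margX q x) by
    rw [← Finset.sum_mul, margX]]
  rw [← Finset.sum_sub_distrib]
  refine Finset.sum_congr rfl fun y _ => ?_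
  rcases (hq.1 x y).eq_or_lt with h | h
  · simp [← h]
  · have hx := h.trans_le (le_margX hq x y)
    have hy := h.trans_le (le_margY hq x y)
    rw [log_div h.ne' (by positivity), log_mul hx.ne' hy.ne', log_div h.ne' hy.ne']
    ring

theorem sum_mul_log_div_margY {q : X → Y → ℝ} (hq : IsJoint q) :
    ∑ x, ∑ y, q x y * log (q x y / margY q y) =
      ∑ x, ∑ y, q x y * log (q x y) - ∑ y, margY q y * log (margY q y) := by
  have h : ∑ y, margY q y * log (margY q y) = ∑ x, ∑ y, q x y * log (margY q y) := by
    rw [Finset.sum_comm]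
    simp only [← Finset.sum_mul, margY]
  simp only [h, ← Finset.sum_sub_distrib]
  refine Finset.sum_congr rfl fun x _ => Finset.sum_congr rfl fun y _ => ?_
  rcases (hq.1 x y).eq_or_lt with h | h
  · simp [← h]
  · rw [log_div h.ne' (h.trans_le (le_margY hq x y)).ne']
    ring

theorem klX_eq_sub {P : X → ℝ} (hP : ∀ x, 0 < P x) (q : X → Y → ℝ) :
    klX q P = ∑ x, margX q x * log (margX q x) - ∑ x, margX q x * log (P x) := by
  simp only [klX, ← Finset.sum_sub_distrib]
  refine Finset.sum_congr rfl fun x _ => ?_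
  rcases eq_or_ne (margX q x) 0 with h | h
  · simp [h]
  · rw [log_div h (hP x).ne', mul_sub]

theorem mul_mutInfo_add_klX {P : X → ℝ} (hP : ∀ x, 0 < P x) (lam : ℝ) {q : X → Y → ℝ}
    (hq : IsJoint q) :
    lam * mutInfo q + klX q P = lam * ∑ x, ∑ y, q x y * log (q x y / margY q y) +
      (1 - lam) * ∑ x, margX q x * log (margX q x) - ∑ x, margX q x * log (P x) := by
  rw [mutInfo_eq_sub hq, klX_eq_sub hP]
  ring

theorem continuousOn_mul_mutInfo_add_klX {P : X → ℝ} (hP : ∀ x, 0 < P x) (lam : ℝ) :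
    ContinuousOn (fun q : X → Y → ℝ => lam * mutInfo q + klX q P) {q | IsJoint q} := by
  have hX : ∀ x, Continuous fun q : X → Y → ℝ => margX q x * log (margX q x) :=
    fun x => continuous_mul_log.comp (continuous_margX x)
  have hY : ∀ y, Continuous fun q : X → Y → ℝ => margY q y * log (margY q y) :=
    fun y => continuous_mul_log.comp (continuous_margY y)
  have hXY : ∀ x y, Continuous fun q : X → Y → ℝ => q x y * log (q x y) :=
    fun x y => continuous_mul_log.comp (by fun_prop)
  have h : Continuous fun q : X → Y → ℝ =>
      lam * (∑ x, ∑ y, q x y * log (q x y) - ∑ y, margY q y * log (margY q y)) +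
      (1 - lam) * ∑ x, margX q x * log (margX q x) - ∑ x, margX q x * log (P x) := by
    fun_prop
  refine h.continuousOn.congr fun q hq => ?_
  simp only [mul_mutInfo_add_klX hP lam hq, sum_mul_log_div_margY hq]

theorem convexOn_sum_mul_log_div_margY :
    ConvexOn ℝ {q : X → Y → ℝ | IsJoint q}
      fun q => ∑ x, ∑ y, q x y * log (q x y / margY q y) := by
  refine ⟨convex_isJoint, fun q hq q' hq' a b ha hb _ => ?_⟩
  simp only [smul_eq_mul, Finset.mul_sum, ← Finset.sum_add_distrib, margY_combo]
  exact Finset.sum_le_sum fun x _ => Finset.sum_le_sum fun y _ =>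
    convex_combo_mul_log_div_le (hq.1 x y) (le_margY hq x y) (hq'.1 x y) (le_margY hq' x y) ha hb

theorem convexOn_sum_margX_mul_log :
    ConvexOn ℝ {q : X → Y → ℝ | IsJoint q} fun q => ∑ x, margX q x * log (margX q x) := by
  refine ⟨convex_isJoint, fun q hq q' hq' a b ha hb hab => ?_⟩
  simp only [smul_eq_mul, Finset.mul_sum, ← Finset.sum_add_distrib, margX_combo]
  exact Finset.sum_le_sum fun x _ => convexOn_mul_log.2 (margX_nonneg hq x) (margX_nonneg hq' x)
    ha hb hab

theorem convexOn_mul_mutInfo_add_klX {P : X → ℝ} (hP : ∀ x, 0 < P x) {lam : ℝ} (h0 : 0 ≤ lam)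
    (h1 : lam ≤ 1) :
    ConvexOn ℝ {q : X → Y → ℝ | IsJoint q} fun q => lam * mutInfo q + klX q P := by
  have hlin : ConcaveOn ℝ {q : X → Y → ℝ | IsJoint q} fun q => ∑ x, margX q x * log (P x) := by
    refine ⟨convex_isJoint, fun q _ q' _ a b _ _ _ => le_of_eq ?_⟩
    simp only [smul_eq_mul, Finset.mul_sum, ← Finset.sum_add_distrib, margX_combo, add_mul,
      mul_assoc]
  refine (((convexOn_sum_mul_log_div_margY.smul h0).add
    (convexOn_sum_margX_mul_log.smul (sub_nonneg.2 h1))).sub hlin).congr fun q hq => ?_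
  exact (mul_mutInfo_add_klX hP lam hq).symm

theorem convexOn_Ed (d : X → Y → ℝ) :
    ConvexOn ℝ {q : X → Y → ℝ | IsJoint q} fun q => Ed q d :=
  ⟨convex_isJoint, fun q _ q' _ a b _ _ _ => (Ed_combo d q q' a b).le⟩

theorem exists_isJoint_Ed_eq_zero {P : X → ℝ} (hP : IsDist P) {d : X → Y → ℝ}
    (hd0 : ∀ x, ∃ y, d x y = 0) : ∃ q : X → Y → ℝ, IsJoint q ∧ Ed q d = 0 := by
  classical
  choose φ hφ using hd0
  refine ⟨fun x y => if y = φ x then P x else 0, ⟨fun x y => ?_, by simpa using hP.2⟩, ?_⟩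
  · dsimp only
    split_ifs
    exacts [hP.1 x, le_rfl]
  · simp [Ed, hφ]

end JointDistributions

/-- for `λ ∈ [0,1]`, `R ≥ 0`, `Δ ≥ 0`:
`G^{(λ)}(R,Δ|P) = sup_{μ ≥ 0} G^{(μ,λ)}(R,Δ|P)`; in particular
`G^{(λ)} ≥ G^{(μ,λ)}` for every `μ ≥ 0`, and for every `ε > 0` there is `μ ≥ 0`
with `G^{(λ)} ≤ G^{(μ,λ)} + ε`. -/
theorem stmt8 {X Y : Type*} [Fintype X] [Fintype Y]
    (P : X → ℝ) (hP : IsDist P) (hPpos : ∀ x, 0 < P x)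
    (d : X → Y → ℝ) (hd : ∀ x y, 0 ≤ d x y) (hd0 : ∀ x, ∃ y, d x y = 0) :
    ∀ lam : ℝ, 0 ≤ lam → lam ≤ 1 → ∀ R Δ : ℝ, 0 ≤ R → 0 ≤ Δ →
      (Glam P d lam R Δ =
        sSup {v : ℝ | ∃ μ : ℝ, 0 ≤ μ ∧ v = Gmulam P d μ lam R Δ}) ∧
      (∀ μ : ℝ, 0 ≤ μ → Gmulam P d μ lam R Δ ≤ Glam P d lam R Δ) ∧
      (∀ ε : ℝ, 0 < ε → ∃ μ : ℝ, 0 ≤ μ ∧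
        Glam P d lam R Δ ≤ Gmulam P d μ lam R Δ + ε) := by
  intro lam h0 h1 R Δ hR hΔ
  obtain ⟨q₀, hq₀, hEq₀⟩ := exists_isJoint_Ed_eq_zero hP hd0
  have hfeas : Ed q₀ d ≤ Δ := hEq₀.trans_le hΔ
  have hcont := continuousOn_mul_mutInfo_add_klX (Y := Y) hPpos lam
  obtain ⟨B, hB⟩ := isCompact_isJoint.bddBelow_image hcont
  have hB : ∀ q : X → Y → ℝ, IsJoint q → B ≤ lam * mutInfo q + klX q P :=
    fun q hq => hB ⟨q, hq, rfl⟩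
  have hGlam : ∀ q, IsJoint q → Ed q d ≤ Δ →
      Glam P d lam R Δ ≤ lam * (mutInfo q - R) + klX q P := fun q hq hE => by
    refine csInf_le ⟨B - lam * R, ?_⟩ ⟨q, hq, hE, rfl⟩
    rintro _ ⟨q, hq, -, rfl⟩
    linarith [hB q hq]
  have hweak : ∀ μ : ℝ, 0 ≤ μ → Gmulam P d μ lam R Δ ≤ Glam P d lam R Δ := fun μ hμ => by
    refine le_csInf ⟨_, q₀, hq₀, hfeas, rfl⟩ ?_
    rintro _ ⟨q, hq, hE, rfl⟩
    have hΩ : OmegaF P d μ lam ≤ lam * mutInfo q + klX q P + μ * Ed q d := by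
      refine csInf_le ⟨B, ?_⟩ ⟨q, hq, rfl⟩
      rintro _ ⟨q, hq, rfl⟩
      linarith [hB q hq, mul_nonneg hμ (Ed_nonneg hq hd)]
    have := mul_le_mul_of_nonneg_left hE hμ
    rw [Gmulam]
    linarith
  have hstrong : ∀ ε : ℝ, 0 < ε → ∃ μ : ℝ, 0 ≤ μ ∧
      Glam P d lam R Δ ≤ Gmulam P d μ lam R Δ + ε := fun ε hε => by
    obtain ⟨μ, hμ, h⟩ := exists_lagrange_multiplier (s := Glam P d lam R Δ + lam * R - ε)
      isCompact_isJoint (convexOn_mul_mutInfo_add_klX hPpos h0 h1) (convexOn_Ed d) hcont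
      (continuous_Ed d).continuousOn hq₀ hfeas fun q hq hE => by linarith [hGlam q hq hE]
    refine ⟨μ, hμ, ?_⟩
    have hΩ : Glam P d lam R Δ + lam * R - ε + μ * Δ ≤ OmegaF P d μ lam := by
      refine le_csInf ⟨_, q₀, hq₀, rfl⟩ ?_
      rintro _ ⟨q, hq, rfl⟩
      exact h q hq
    rw [Gmulam]
    linarith
  refine ⟨le_antisymm (le_of_forall_pos_le_add fun ε hε => ?_) ?_, hweak, hstrong⟩
  · obtain ⟨μ, hμ, h⟩ := hstrong ε hε
    have hle : Gmulam P d μ lam R Δ ≤ sSup {v : ℝ | ∃ μ : ℝ, 0 ≤ μ ∧ v = Gmulam P d μ lam R Δ} := by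
      refine le_csSup ⟨Glam P d lam R Δ, ?_⟩ ⟨μ, hμ, rfl⟩
      rintro _ ⟨μ, hμ, rfl⟩
      exact hweak μ hμ
    linarith
  · refine csSup_le ⟨_, 0, le_rfl, rfl⟩ ?_
    rintro _ ⟨μ, hμ, rfl⟩
    exact hweak μ hμ
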